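/- arXiv:1909.10412 — 2 statements merged into one kernel-verified Lean document; each statement's English description precedes it below -/
import Mathlib

section
/- Let X be a nonempty set, n ≥ 3, and let (X,F) be an n-ary monoid, i.e., F : X^n → X is associative and E_F is nonempty. Then (E_F, F|_{E_F^n}) is the n-ary extension of an Abelian group whose exponent divides n-1: there exists a binary operation G : E_F^2 → E_F such that (E_F, G) is an Abelian group with x^{n-1} equal to its neutral element for every x ∈ E_F, and F(e_1,…,e_n) = G(e_1, G(e_2, …, G(e_{n-1}, e_n)…)) for all e_1,…,e_n ∈ E_F. -/
variable {X : Type*}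

/-- The result of substituting `F` applied to the `n` consecutive entries starting at
position `i` of the `(2n-1)`-tuple `x` (given as the first `2n-1` values of `x : ℕ → X`),
and then applying `F` to the resulting `n`-tuple. -/
def naryCompAt (n : ℕ) (F : (Fin n → X) → X) (x : ℕ → X) (i : ℕ) : X :=
  F fun j => if (j : ℕ) < i then x j
    else if (j : ℕ) = i then F (fun k => x (i + (k : ℕ)))
    else x ((j : ℕ) + n - 1)

/-- `F` is an associative `n`-ary operation. -/
def NAryAssociative (n : ℕ) (F : (Fin n → X) → X) : Prop :=
  ∀ (x : ℕ → X) (i : ℕ), i + 1 ≤ n - 1 → naryCompAt n F x i = naryCompAt n F x (i + 1)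

/-- `e` is a neutral element for the `n`-ary operation `F`: inserting the argument `a` at
any position `p`, with `e` at all the other positions, returns `a`. -/
def NAryNeutral (n : ℕ) (F : (Fin n → X) → X) (e : X) : Prop :=
  ∀ (a : X) (p : Fin n), F (Function.update (fun _ => e) p a) = a

/-- The set `E_F` of neutral elements for `F`. -/
def naryNeutralSet (n : ℕ) (F : (Fin n → X) → X) : Set X :=
  {e | NAryNeutral n F e}

/-- `e` is a neutral element for the restriction of `F` to `S^n`. -/
def NAryNeutralOn (n : ℕ) (F : (Fin n → X) → X) (S : Set X) (e : X) : Prop :=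
  e ∈ S ∧ ∀ a ∈ S, ∀ p : Fin n, F (Function.update (fun _ => e) p a) = a

/-- `iterOp G m x = G (x 0) (G (x 1) (⋯ (G (x (m-1)) (x m))⋯))`,
the `m`-fold iterate of the binary operation `G`, applied to `m+1` arguments. -/
def iterOp (G : X → X → X) : ℕ → (ℕ → X) → X
  | 0, x => x 0
  | m + 1, x => G (x 0) (iterOp G m fun i => x (i + 1))

/-- The `n`-ary operation `F` is reducible to the binary operation `G`, i.e. `F` is the
`(n-1)`-fold iterate of `G`. -/
def NAryReducibleTo (n : ℕ) (F : (Fin n → X) → X) (G : X → X → X) : Prop :=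
  ∀ x : ℕ → X, F (fun i : Fin n => x i) = iterOp G (n - 1) x

/-- `gPow G a m` is the `G`-product of `m + 1` copies of `a`. -/
def gPow (G : X → X → X) (a : X) : ℕ → X
  | 0 => a
  | m + 1 => G a (gPow G a m)

/-- `(Y, G)` is an Abelian group whose exponent divides `m` (for `m ≥ 1`): `G` maps `Y × Y`
into `Y` and is commutative and associative on `Y`, and `Y` contains a neutral element `e`
for which every element of `Y` has an inverse and such that the `G`-product of `m` copies of
any element of `Y` equals `e`. -/
def IsAbelianGroupOfExpDvdOn (Y : Set X) (G : X → X → X) (m : ℕ) : Prop :=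
  (∀ a ∈ Y, ∀ b ∈ Y, G a b ∈ Y) ∧
  (∀ a ∈ Y, ∀ b ∈ Y, G a b = G b a) ∧
  (∀ a ∈ Y, ∀ b ∈ Y, ∀ c ∈ Y, G (G a b) c = G a (G b c)) ∧
  ∃ e ∈ Y, (∀ a ∈ Y, G e a = a) ∧ (∀ a ∈ Y, ∃ b ∈ Y, G a b = e) ∧
    (∀ a ∈ Y, gPow G a (m - 1) = e)

/-- The tuple `x` lies in `D^n_k`: at least `k` of its components are equal to each other. -/
def MemD (n k : ℕ) (x : Fin n → X) : Prop :=
  ∃ S : Finset (Fin n), k ≤ S.card ∧ ∀ i ∈ S, ∀ j ∈ S, x i = x j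

/-- `F` is quasitrivial on `D^n_k`. -/
def NAryQuasitrivialOnD (n k : ℕ) (F : (Fin n → X) → X) : Prop :=
  ∀ x : Fin n → X, MemD n k x → F x ∈ Set.range x

/-- `F` is quasitrivial on `S^n_k`, the set of tuples taking at most `k` distinct values. -/
def NAryQuasitrivialOnS (n k : ℕ) (F : (Fin n → X) → X) : Prop :=
  ∀ x : Fin n → X, (Set.range x).encard ≤ k → F x ∈ Set.range x

/-- `F` is quasitrivial. -/
def NAryQuasitrivial (n : ℕ) (F : (Fin n → X) → X) : Prop :=
  ∀ x : Fin n → X, F x ∈ Set.range x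

theorem NAryNeutral.apply_eq {X : Type*} {n : ℕ} {F : (Fin n → X) → X} {e : X}
    (he : NAryNeutral n F e) {x : Fin n → X} (p : Fin n) (hx : ∀ j, j ≠ p → x j = e) :
    F x = x p := by
  rw [← he (x p) p]
  congr 1
  funext j
  by_cases hj : j = p
  · subst hj
    simp
  · simp [hj, hx j hj]

theorem NAryAssociative.naryCompAt_eq {X : Type*} {n : ℕ} {F : (Fin n → X) → X}
    (hF : NAryAssociative n F) (x : ℕ → X) {i : ℕ} (hi : i ≤ n - 1) :
    naryCompAt n F x i = naryCompAt n F x (n - 1) := by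
  induction hi using Nat.decreasingInduction with
  | self => rfl
  | of_succ k hk ih => rw [hF x k hk, ih]

/-- The binary operation `(a, b) ↦ F (a, e, …, e, b)`. -/
def naryReduct {X : Type*} (n : ℕ) (F : (Fin n → X) → X) (e a b : X) : X :=
  F fun j => if (j : ℕ) = 0 then a else if (j : ℕ) = n - 1 then b else e

theorem naryReduct_neutral_left {X : Type*} {n : ℕ} (hn : 3 ≤ n) {F : (Fin n → X) → X} {e : X}
    (he : NAryNeutral n F e) (a : X) : naryReduct n F e e a = a := by
  unfold naryReduct
  rw [he.apply_eq ⟨n - 1, by omega⟩]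
  · simp; omega
  · intro j hj
    have : (j : ℕ) ≠ n - 1 := fun h => hj (Fin.ext h)
    simp [this]

theorem naryReduct_neutral_right {X : Type*} {n : ℕ} (hn : 3 ≤ n) {F : (Fin n → X) → X} {e : X}
    (he : NAryNeutral n F e) (a : X) : naryReduct n F e a e = a := by
  unfold naryReduct
  rw [he.apply_eq ⟨0, by omega⟩]
  · simp
  · intro j hj
    have : (j : ℕ) ≠ 0 := fun h => hj (Fin.ext h)
    simp [this]

theorem naryReduct_assoc {X : Type*} {n : ℕ} (hn : 3 ≤ n) {F : (Fin n → X) → X}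
    (hF : NAryAssociative n F) (e a b c : X) :
    naryReduct n F e (naryReduct n F e a b) c = naryReduct n F e a (naryReduct n F e b c) := by
  have h := hF.naryCompAt_eq
    (fun j => if j = 0 then a else if j = n - 1 then b else if j = 2 * n - 2 then c else e)
    (Nat.zero_le _)
  convert h using 1
  · refine congrArg F (funext fun j => ?_)
    have hj := j.isLt
    by_cases h0 : (j : ℕ) = 0
    · simp only [h0, if_true, lt_irrefl, if_false]
      refine congrArg F (funext fun k => ?_)
      have hk := k.isLt
      split_ifs <;> first | rfl | omega
    · simp only [h0, if_false, Nat.not_lt_zero]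
      split_ifs <;> first | rfl | omega
  · refine congrArg F (funext fun j => ?_)
    have hj := j.isLt
    by_cases h1 : (j : ℕ) = n - 1
    · have h0 : n - 1 ≠ 0 := by omega
      simp only [h1, h0, if_true, lt_irrefl, if_false]
      refine congrArg F (funext fun k => ?_)
      have hk := k.isLt
      split_ifs <;> first | rfl | omega
    · have h2 : (j : ℕ) < n - 1 := by omega
      simp only [h1, h2, if_true, if_false]
      split_ifs <;> first | rfl | omega

theorem apply_padded_eq_iterOp {X : Type*} {n : ℕ} (hn : 3 ≤ n) {F : (Fin n → X) → X}
    (hF : NAryAssociative n F) {e : X} (he : NAryNeutral n F e) (m : ℕ) (hm : m ≤ n - 1)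
    (x : ℕ → X) :
    F (fun j => if (j : ℕ) = 0 then x 0 else if (j : ℕ) ≤ n - 1 - m then e
      else x (j + m + 1 - n)) = iterOp (naryReduct n F e) m x := by
  induction m generalizing x with
  | zero =>
    rw [he.apply_eq ⟨0, by omega⟩]
    · simp [iterOp]
    · intro j hj
      have h0 : (j : ℕ) ≠ 0 := fun h => hj (Fin.ext h)
      have h1 : (j : ℕ) ≤ n - 1 := by omega
      simp [h0, h1]
  | succ m ih =>
    rw [iterOp, ← ih (by omega)]
    have h := hF.naryCompAt_eq
      (fun j => if j = 0 then x 0 else if j = n - 1 then x 1 else if j ≤ 2 * n - 2 - m then e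
        else x (j + m + 3 - 2 * n)) (i := n - 1 - m) (by omega)
    convert h using 1
    · refine congrArg F (funext fun j => ?_)
      have hj := j.isLt
      by_cases h1 : (j : ℕ) = n - 1 - m
      · have h0 : n - 1 - m ≠ 0 := by omega
        simp only [h1, h0, if_true, lt_irrefl, if_false]
        rw [he.apply_eq ⟨m, by omega⟩]
        · dsimp only
          split_ifs <;> first | omega | (congr 1; omega)
        · intro k hk
          have hk' := k.isLt
          have : (k : ℕ) ≠ m := fun h => hk (Fin.ext h)
          split_ifs <;> first | rfl | omega
      · simp only [h1, if_false]
        split_ifs <;> first | rfl | omega | (congr 1; omega)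
    · refine congrArg F (funext fun j => ?_)
      have hj := j.isLt
      by_cases h1 : (j : ℕ) = n - 1
      · have h0 : n - 1 ≠ 0 := by omega
        simp only [h1, h0, if_true, lt_irrefl, if_false]
        refine congrArg F (funext fun k => ?_)
        have hk := k.isLt
        split_ifs <;> first | rfl | omega | (congr 1; omega)
      · have h2 : (j : ℕ) < n - 1 := by omega
        simp only [h1, h2, if_true, if_false]
        split_ifs <;> first | rfl | omega

theorem naryReducibleTo_naryReduct {X : Type*} {n : ℕ} (hn : 3 ≤ n) {F : (Fin n → X) → X}
    (hF : NAryAssociative n F) {e : X} (he : NAryNeutral n F e) :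
    NAryReducibleTo n F (naryReduct n F e) := by
  intro x
  rw [← apply_padded_eq_iterOp hn hF he (n - 1) le_rfl]
  refine congrArg F (funext fun j => ?_)
  split_ifs with h0 h1
  · rw [h0]
  · omega
  · congr 1
    omega

theorem gPow_mul {M : Type*} [Monoid M] (a : M) (m : ℕ) :
    gPow (fun a b : M => a * b) a m = a ^ (m + 1) := by
  induction m with
  | zero => simp [gPow]
  | succ m ih => rw [gPow, ih, pow_succ' a (m + 1)]

theorem iterOp_mul_const {M : Type*} [Monoid M] (f : M) (m : ℕ) :
    iterOp (fun a b : M => a * b) m (fun _ => f) = f ^ (m + 1) := by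
  induction m with
  | zero => simp [iterOp]
  | succ m ih => rw [iterOp, ih, pow_succ' f (m + 1)]

theorem iterOp_mul_update_of_commute {M : Type*} [Monoid M] {a f : M} (h : Commute f a)
    (m p : ℕ) (hp : p ≤ m) :
    iterOp (fun a b : M => a * b) m (fun i => if i = p then a else f) = a * f ^ m := by
  induction m generalizing p with
  | zero =>
    obtain rfl : p = 0 := by omega
    simp [iterOp]
  | succ m ih =>
    rw [iterOp]
    rcases p with _ | p
    · simp [iterOp_mul_const]
    · simp only [Nat.add_right_cancel_iff]
      rw [ih p (by omega), if_neg (by omega), ← mul_assoc, h.eq, mul_assoc, pow_succ']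

theorem apply_update_eq_iterOp {X : Type*} {n : ℕ} {F : (Fin n → X) → X} {G : X → X → X}
    (h : NAryReducibleTo n F G) (f a : X) (p : Fin n) :
    F (Function.update (fun _ => f) p a) =
      iterOp G (n - 1) (fun i => if i = (p : ℕ) then a else f) := by
  rw [← h]
  refine congrArg F (funext fun j => ?_)
  simp [Function.update_apply, Fin.ext_iff]

/-- The neutral elements of the `n`-ary extension of a monoid are the central elements whose
order divides `n - 1`. -/
theorem mem_naryNeutralSet_iff {M : Type*} [Monoid M] {n : ℕ} (hn : 3 ≤ n)
    {F : (Fin n → M) → M} (h : NAryReducibleTo n F fun a b => a * b) {f : M} :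
    f ∈ naryNeutralSet n F ↔ (∀ a, Commute f a) ∧ f ^ (n - 1) = 1 := by
  obtain ⟨m, rfl⟩ : ∃ m, n = m + 3 := ⟨n - 3, by omega⟩
  simp only [Nat.add_succ_sub_one]
  constructor
  · intro hf
    have hpow : f ^ (m + 2) = 1 := by
      have h0 := hf 1 ⟨0, by omega⟩
      rw [apply_update_eq_iterOp h,
        iterOp_mul_update_of_commute (Commute.one_right f) _ _ (by simp)] at h0
      simpa using h0
    refine ⟨fun a => ?_, hpow⟩
    have h1 : f * (a * f ^ (m + 1)) = a := by
      have h1 := hf a ⟨1, by omega⟩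
      rw [apply_update_eq_iterOp h] at h1
      simpa [iterOp, iterOp_mul_const] using h1
    calc f * a = f * (a * f ^ (m + 2)) := by rw [hpow, mul_one]
      _ = f * (a * f ^ (m + 1)) * f := by rw [pow_succ f (m + 1)]; simp only [mul_assoc]
      _ = a * f := by rw [h1]
  · rintro ⟨hc, hpow⟩ a p
    rw [apply_update_eq_iterOp h, iterOp_mul_update_of_commute (hc a) _ _ (by omega)]
    simp [hpow]

theorem isAbelianGroupOfExpDvdOn_naryNeutralSet {M : Type*} [Monoid M] {n : ℕ} (hn : 3 ≤ n)
    {F : (Fin n → M) → M} (h : NAryReducibleTo n F fun a b => a * b) :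
    IsAbelianGroupOfExpDvdOn (naryNeutralSet n F) (fun a b => a * b) (n - 1) := by
  simp only [IsAbelianGroupOfExpDvdOn, mem_naryNeutralSet_iff hn h]
  refine ⟨?_, fun a ha b _ => ha.1 b, fun a _ b _ c _ => mul_assoc a b c,
    1, ⟨Commute.one_left, one_pow _⟩, fun a _ => one_mul a, ?_, ?_⟩
  · rintro a ⟨ha, ha'⟩ b ⟨hb, hb'⟩
    exact ⟨fun c => (ha c).mul_left (hb c), by rw [(ha b).mul_pow, ha', hb', one_mul]⟩
  · rintro a ⟨ha, ha'⟩
    refine ⟨a ^ (n - 2), ⟨fun c => (ha c).pow_left _, ?_⟩, ?_⟩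
    · rw [← pow_mul, mul_comm, pow_mul, ha', one_pow]
    · rw [← pow_succ', show n - 2 + 1 = n - 1 by omega, ha']
  · rintro a ⟨_, ha'⟩
    rw [gPow_mul, show n - 1 - 1 + 1 = n - 1 by omega, ha']

/-- If `(X, F)` is an `n`-ary monoid, then `(E_F, F|_{E_F^n})` is the `n`-ary extension of
an Abelian group whose exponent divides `n - 1`. -/
theorem stmt_8 {X : Type*} [Nonempty X] (n : ℕ) (hn : 3 ≤ n)
    (F : (Fin n → X) → X) (hF : NAryAssociative n F)
    (hE : (naryNeutralSet n F).Nonempty) :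
    ∃ G : X → X → X, IsAbelianGroupOfExpDvdOn (naryNeutralSet n F) G (n - 1) ∧
      ∀ x : ℕ → X, (∀ i < n, x i ∈ naryNeutralSet n F) →
        F (fun i : Fin n => x i) = iterOp G (n - 1) x := by
  obtain ⟨e, he⟩ := hE
  have h := naryReducibleTo_naryReduct hn hF he
  let : Monoid X :=
    { mul := naryReduct n F e
      one := e
      mul_assoc := naryReduct_assoc hn hF e
      one_mul := naryReduct_neutral_left hn he
      mul_one := naryReduct_neutral_right hn he }
  exact ⟨naryReduct n F e, isAbelianGroupOfExpDvdOn_naryNeutralSet hn h, fun x _ => h x⟩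
end

section
/- Let X be a nonempty set, n ≥ 3, and let F : X^n → X be associative and quasitrivial on D^n_{n-1}. If a_1,…,a_n ∈ X are such that F(a_1,…,a_n) ∉ {a_1,…,a_n}, then each a_i is a neutral element for F and F(a_1,…,a_n) is a neutral element for F. Consequently, the restriction of F to (X \ E_F)^n is quasitrivial. -/
variable {X : Type*}

/-- A family `ι : X → S` of elements of a monoid such that multiplying `ι y` on either side by
`ι x ^ m` yields `ι x` or `ι y`. -/
structure PowQuasitrivial {X S : Type*} [Monoid S] (ι : X → S) (m : ℕ) : Prop where
  injective : Function.Injective ι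
  pos : 0 < m
  left : ∀ x y, ι x ^ m * ι y = ι x ∨ ι x ^ m * ι y = ι y
  right : ∀ x y, ι x * ι y ^ m = ι x ∨ ι x * ι y ^ m = ι y

namespace PowQuasitrivial

variable {S : Type*} [Monoid S] {ι : X → S} {m : ℕ}

theorem pow_mul_self (h : PowQuasitrivial ι m) (x : X) : ι x ^ m * ι x = ι x := by
  rcases h.left x x with h | h <;> exact h

theorem self_mul_pow (h : PowQuasitrivial ι m) (x : X) : ι x * ι x ^ m = ι x := by
  rcases h.right x x with h | h <;> exact h

theorem pow_eq_pred_mul (h : PowQuasitrivial ι m) (x : X) :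
    ι x ^ m = ι x ^ (m - 1) * ι x := by
  rw [← pow_succ, Nat.sub_add_cancel h.pos]

theorem pow_eq_mul_pred (h : PowQuasitrivial ι m) (x : X) :
    ι x ^ m = ι x * ι x ^ (m - 1) := by
  rw [← pow_succ', Nat.sub_add_cancel h.pos]

theorem dichotomy (h : PowQuasitrivial ι m) {x y : X} (hxy : ι x ^ m ≠ ι y ^ m) :
    (ι x ^ m * ι y = ι x ∧ ι x * ι y ^ m = ι x) ∨
      (ι x ^ m * ι y = ι y ∧ ι x * ι y ^ m = ι y) := by
  rcases h.left x y with h1 | h1 <;> rcases h.right x y with h2 | h2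
  · exact Or.inl ⟨h1, h2⟩
  · exfalso
    apply hxy
    have : ι x = ι y := by
      calc ι x = ι x ^ m * ι y := h1.symm
        _ = ι x ^ m * (ι x * ι y ^ m) := by rw [h2]
        _ = ι y := by rw [← mul_assoc, h.pow_mul_self, h2]
    rw [this]
  · exfalso
    apply hxy
    calc ι x ^ m = ι x ^ (m - 1) * (ι x * ι y ^ m) := by rw [h2, ← h.pow_eq_pred_mul]
      _ = ι x ^ m * ι y ^ m := by rw [← mul_assoc, ← h.pow_eq_pred_mul]
      _ = ι y ^ m := by rw [h.pow_eq_mul_pred y, ← mul_assoc, h1]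
  · exact Or.inr ⟨h1, h2⟩

theorem eq_of_pow_eq_of_left (h : PowQuasitrivial ι m) {x y : X} (hxy : ι x ^ m ≠ ι y ^ m)
    (hw : ι x ^ m * ι y = ι x) (z : X) (hz : ι z ^ m = ι x ^ m) : z = x := by
  rcases h.dichotomy (hz ▸ hxy) with h1 | h1
  · exact h.injective (by rw [← h1.1, hz, hw])
  · exact absurd (by rw [← hw, ← hz, h1.1]) hxy

theorem eq_of_pow_eq_of_right (h : PowQuasitrivial ι m) {x y : X} (hxy : ι x ^ m ≠ ι y ^ m)
    (hw : ι x * ι y ^ m = ι y) (z : X) (hz : ι z ^ m = ι y ^ m) : z = y := by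
  rcases h.dichotomy (hz ▸ hxy) with h1 | h1
  · exact absurd (by rw [← hw, ← hz, h1.2]) hxy
  · exact h.injective (by rw [← h1.2, hz, hw])

theorem mul_eq_of_left (h : PowQuasitrivial ι m) {x y : X} (hw : ι x ^ m * ι y = ι x) :
    ι x * ι y = ι x * ι x := by
  conv_lhs => rw [← h.self_mul_pow x, mul_assoc, hw]

theorem mul_eq_of_right (h : PowQuasitrivial ι m) {x y : X} (hw : ι x * ι y ^ m = ι y) :
    ι x * ι y = ι y * ι y := by
  conv_lhs => rw [← h.pow_mul_self y, ← mul_assoc, hw]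

/-- A product whose factors do not all have the same `m`-th power collapses to a power of one
of its factors. -/
theorem prod_eq_pow_or_pow_eq (h : PowQuasitrivial ι m) (a : X) (l : List X) :
    (∀ x ∈ l, ι x ^ m = ι a ^ m) ∨
      ∃ x ∈ a :: l, (∀ z, ι z ^ m = ι x ^ m → z = x) ∧
        ((a :: l).map ι).prod = ι x ^ (l.length + 1) := by
  have pow_collapse : ∀ (a : X) (l : List X), (∀ d ∈ l, ι a * ι d = ι a * ι a) →
      ι a * (l.map ι).prod = ι a ^ (l.length + 1) := by
    intro a l
    induction l with
    | nil => simp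
    | cons d l ih =>
      intro hl
      rw [List.map_cons, List.prod_cons, ← mul_assoc, hl d (by simp), mul_assoc,
        ih fun d hd => hl d (by simp [hd]), List.length_cons, ← pow_succ']
  have absorb : ∀ (a x : X) (k : ℕ), ι a * ι x = ι x * ι x →
      ι a * ι x ^ (k + 1) = ι x ^ (k + 1 + 1) := by
    intro a x k hk
    rw [pow_succ', ← mul_assoc, hk, mul_assoc, ← pow_succ', ← pow_succ']
  induction l generalizing a with
  | nil => left; simp
  | cons c l ih =>
    rcases ih c with hsame | ⟨x, hx, hsing, hprod⟩
    · by_cases hac : ι a ^ m = ι c ^ m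
      · left
        intro x hx
        rcases List.mem_cons.1 hx with rfl | hx
        · exact hac.symm
        · rw [hsame x hx, hac]
      · right
        have hsame' : ∀ d ∈ c :: l, ι d ^ m = ι c ^ m := by
          intro d hd
          rcases List.mem_cons.1 hd with rfl | hd
          · rfl
          · exact hsame d hd
        rcases h.dichotomy hac with hw | hw
        · refine ⟨a, by simp, h.eq_of_pow_eq_of_left hac hw.1, ?_⟩
          rw [List.map_cons, List.prod_cons]
          apply pow_collapse
          intro d hd
          have hd' := hsame' d hd
          rcases h.dichotomy (show ι a ^ m ≠ ι d ^ m by rwa [hd']) with h1 | h1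
          · exact h.mul_eq_of_left h1.1
          · rw [← h1.2, hd', hw.2]
        · have hsing := h.eq_of_pow_eq_of_right hac hw.2
          refine ⟨c, by simp, hsing, ?_⟩
          have hrep : c :: l = List.replicate (l.length + 1) c :=
            List.eq_replicate_iff.2 ⟨by simp, fun d hd => hsing d (hsame' d hd)⟩
          rw [List.map_cons, List.prod_cons, List.length_cons,
            ← absorb a c _ (h.mul_eq_of_right hw.2)]
          congr 1
          conv_lhs => rw [hrep]
          simp
    · right
      by_cases hax : ι a ^ m = ι x ^ m
      · obtain rfl := hsing a hax
        refine ⟨a, by simp, hsing, ?_⟩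
        rw [List.map_cons, List.prod_cons, hprod, List.length_cons, ← pow_succ']
      · rcases h.dichotomy hax with hw | hw
        · refine ⟨a, by simp, h.eq_of_pow_eq_of_left hax hw.1, ?_⟩
          rw [List.map_cons, List.prod_cons, hprod, List.length_cons]
          have := pow_collapse a (List.replicate (l.length + 1) x)
            fun d hd => by rw [List.eq_of_mem_replicate hd, h.mul_eq_of_left hw.1]
          simpa using this
        · refine ⟨x, by simp [List.mem_cons.1 hx], hsing, ?_⟩
          rw [List.map_cons, List.prod_cons, hprod, List.length_cons,
            absorb a x _ (h.mul_eq_of_right hw.2)]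

/-- If a product of `m + 1` members of the family is a member `b` distinct from all the
factors, then the `m`-th powers of the factors and of `b` act as an identity. -/
theorem pow_mul_eq_of_prod_eq (h : PowQuasitrivial ι m) (l : List X) (hl : l.length = m + 1)
    (b : X) (hb : (l.map ι).prod = ι b) (hbl : b ∉ l) :
    ∀ x ∈ b :: l, ∀ y, ι x ^ m * ι y = ι y ∧ ι y * ι x ^ m = ι y := by
  obtain ⟨a, l, rfl⟩ := List.exists_cons_of_ne_nil (List.ne_nil_of_length_eq_add_one hl)
  have hlen : l.length = m := by simpa using hl
  have hpow : ∀ x ∈ a :: l, ((a :: l).map ι).prod ≠ ι x ^ (m + 1) := by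
    intro x hx hp
    rw [hb, pow_succ, h.pow_mul_self] at hp
    exact hbl (h.injective hp ▸ hx)
  have hsame : ∀ x ∈ a :: l, ι x ^ m = ι a ^ m := by
    rcases h.prod_eq_pow_or_pow_eq a l with h1 | ⟨x, hx, -, hp⟩
    · simpa using h1
    · exact absurd (hlen ▸ hp) (hpow x hx)
  have hsing : ¬ ∀ z, ι z ^ m = ι a ^ m → z = a := by
    intro hs
    have hrep : a :: l = List.replicate (m + 1) a :=
      List.eq_replicate_iff.2 ⟨hl, fun d hd => hs d (hsame d hd)⟩
    refine hpow a (by simp) ?_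
    rw [hrep]
    simp
  have hid : ∀ y, ι a ^ m * ι y = ι y ∧ ι y * ι a ^ m = ι y := by
    intro y
    by_cases hay : ι a ^ m = ι y ^ m
    · rw [hay]
      exact ⟨h.pow_mul_self y, h.self_mul_pow y⟩
    · constructor
      · rcases h.dichotomy hay with h1 | h1
        · exact absurd (h.eq_of_pow_eq_of_left hay h1.1) hsing
        · exact h1.1
      · rcases h.dichotomy (Ne.symm hay) with h1 | h1
        · exact h1.2
        · exact absurd (h.eq_of_pow_eq_of_right (Ne.symm hay) h1.2) hsing
  have hinv : ∀ l : List X, (∀ x ∈ l, ι x ^ m = ι a ^ m) →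
      ∃ u, (l.map ι).prod * u = ι a ^ m := by
    intro l
    induction l with
    | nil => exact fun _ => ⟨ι a ^ m, by simp⟩
    | cons c l ih =>
      intro hl
      obtain ⟨u, hu⟩ := ih fun x hx => hl x (by simp [hx])
      refine ⟨u * ι c ^ (m - 1), ?_⟩
      rw [List.map_cons, List.prod_cons, mul_assoc, ← mul_assoc _ u, hu, ← mul_assoc,
        (hid c).2, ← h.pow_eq_mul_pred, hl c (by simp)]
  have hbpow : ι b ^ m = ι a ^ m := by
    obtain ⟨u, hu⟩ := hinv (a :: l) hsame
    rw [hb] at hu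
    calc ι b ^ m = ι b ^ m * ι a ^ m := by
          rw [h.pow_eq_pred_mul b, mul_assoc, (hid b).2]
      _ = ι a ^ m := by rw [← hu, ← mul_assoc, h.pow_mul_self]
  intro x hx y
  have : ι x ^ m = ι a ^ m := by
    rcases List.mem_cons.1 hx with rfl | hx
    · exact hbpow
    · exact hsame x hx
  rw [this]
  exact hid y

end PowQuasitrivial

section Words

variable (n : ℕ)

/-- An `n`-ary operation applied to the first `n` entries of a list. -/
noncomputable def listOp [Nonempty X] (F : (Fin n → X) → X) (l : List X) : X :=
  F fun i => l.getD i (Classical.arbitrary X)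

variable (f : List X → X)

/-- Repeatedly replace the first `n` letters of a word by their image under `f`. -/
def reduceWord (w : List X) : List X :=
  if 2 ≤ n ∧ n ≤ w.length then reduceWord (f (w.take n) :: w.drop n) else w
termination_by w.length
decreasing_by simp; omega

/-- The left-normed product of a word, set to be empty when the length of the word is not
congruent to `1` modulo `n - 1`. -/
def wordEval (w : List X) : List X :=
  if w.length ≡ 1 [MOD n - 1] then reduceWord n f w else []

variable {n f}

theorem reduceWord_append (hn : 2 ≤ n) {l : List X} (hl : l.length = n) (q : List X) :
    reduceWord n f (l ++ q) = reduceWord n f (f l :: q) := by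
  rw [reduceWord, if_pos ⟨hn, by simp [hl]⟩]
  subst hl
  simp

theorem reduceWord_collapse (hn : 2 ≤ n)
    (hf : ∀ p l q : List X, l.length = n → p.length + q.length = n - 1 →
      f (p ++ f l :: q) = f (f ((p ++ l ++ q).take n) :: (p ++ l ++ q).drop n))
    {l : List X} (hl : l.length = n) (p q : List X)
    (hpq : n - 1 ∣ p.length + q.length) :
    reduceWord n f (p ++ l ++ q) = reduceWord n f (p ++ f l :: q) := by
  induction hk : p.length using Nat.strong_induction_on generalizing p with
  | _ k ih =>
    subst hk
    rcases Nat.lt_or_ge p.length n with hp | hp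
    · rcases Nat.eq_zero_or_pos p.length with h0 | h0
      · obtain rfl := List.length_eq_zero_iff.1 h0
        simpa using reduceWord_append hn hl q
      · have hle := Nat.le_of_dvd (by omega) hpq
        obtain ⟨q₁, q₂, rfl, hq⟩ : ∃ q₁ q₂, q = q₁ ++ q₂ ∧ p.length + q₁.length = n - 1 :=
          ⟨q.take (n - 1 - p.length), q.drop (n - 1 - p.length), by simp, by simp; omega⟩
        have hr : reduceWord n f (p ++ f l :: (q₁ ++ q₂)) =
            reduceWord n f (f (p ++ f l :: q₁) :: q₂) := by
          rw [← reduceWord_append hn (by simp; omega)]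
          simp
        rw [hr, hf p l q₁ hl hq, ← reduceWord_append hn (by simp; omega), List.cons_append,
          ← reduceWord_append hn (by simp; omega)]
        conv_rhs => rw [← List.append_assoc, List.take_append_drop]
        simp
    · obtain ⟨p₁, p₂, rfl, hp₁⟩ : ∃ p₁ p₂, p = p₁ ++ p₂ ∧ p₁.length = n :=
        ⟨p.take n, p.drop n, by simp, by simp; omega⟩
      have hlen : (f p₁ :: p₂).length + (n - 1) = (p₁ ++ p₂).length := by simp; omega
      have := ih (f p₁ :: p₂).length (by omega) (f p₁ :: p₂)
        ((Nat.dvd_add_left (dvd_refl (n - 1))).1 (by convert hpq using 1; omega)) rfl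
      simp only [List.append_assoc] at this ⊢
      rw [reduceWord_append hn hp₁, reduceWord_append hn hp₁]
      exact this

theorem wordEval_collapse (hn : 2 ≤ n)
    (hf : ∀ p l q : List X, l.length = n → p.length + q.length = n - 1 →
      f (p ++ f l :: q) = f (f ((p ++ l ++ q).take n) :: (p ++ l ++ q).drop n))
    {l : List X} (hl : l.length = n) (p q : List X) :
    wordEval n f (p ++ l ++ q) = wordEval n f (p ++ f l :: q) := by
  have h1 : (p ++ l ++ q).length = (p ++ f l :: q).length + (n - 1) := by simp; omega
  have h2 : (p ++ f l :: q).length = 1 + (p.length + q.length) := by simp; omega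
  by_cases h : (p ++ f l :: q).length ≡ 1 [MOD n - 1]
  · have hd : n - 1 ∣ p.length + q.length := by
      rw [h2] at h
      simpa using (Nat.modEq_iff_dvd' (by omega)).1 h.symm
    rw [wordEval, wordEval, if_pos h, if_pos (by rw [h1]; simpa [Nat.ModEq] using h),
      reduceWord_collapse hn hf hl p q hd]
  · rw [wordEval, wordEval, if_neg h, if_neg (by rw [h1]; simpa [Nat.ModEq] using h)]

theorem wordEval_singleton (hn : 2 ≤ n) (x : X) : wordEval n f [x] = [x] := by
  rw [wordEval, if_pos (by simp [Nat.ModEq]), reduceWord, if_neg (by simp; omega)]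

/-- Two words are congruent when they have the same evaluation in every context. -/
def syntacticCon {Y : Type*} (P : List X → Y) : Con (FreeMonoid X) where
  r u v := ∀ p q : FreeMonoid X, P (p * u * q).toList = P (p * v * q).toList
  iseqv := ⟨fun _ _ _ => rfl, fun h p q => (h p q).symm, fun h k p q => (h p q).trans (k p q)⟩
  mul' {u v w z} h k p q := by
    have h1 := h p (w * q)
    have h2 := k (p * v) q
    simp only [mul_assoc] at h1 h2 ⊢
    exact h1.trans h2

theorem exists_monoid_embedding.{u} {X : Type u} {f : List X → X} (hn : 2 ≤ n)
    (hf : ∀ p l q : List X, l.length = n → p.length + q.length = n - 1 →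
      f (p ++ f l :: q) = f (f ((p ++ l ++ q).take n) :: (p ++ l ++ q).drop n)) :
    ∃ (S : Type u) (_ : Monoid S) (ι : X → S), Function.Injective ι ∧
      ∀ l : List X, l.length = n → (l.map ι).prod = ι (f l) := by
  refine ⟨(syntacticCon (wordEval n f)).Quotient, inferInstance,
    fun x => ((FreeMonoid.of x : FreeMonoid X) : (syntacticCon (wordEval n f)).Quotient), ?_, ?_⟩
  · intro x y hxy
    have := (Con.eq _).1 hxy 1 1
    simpa [wordEval_singleton hn] using this
  · intro l hl
    have hprod : (l.map fun x =>
        ((FreeMonoid.of x : FreeMonoid X) : (syntacticCon (wordEval n f)).Quotient)).prod =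
        ((FreeMonoid.ofList l : FreeMonoid X) : (syntacticCon (wordEval n f)).Quotient) := by
      clear hl
      induction l with
      | nil => rfl
      | cons a l ih => rw [List.map_cons, List.prod_cons, ih, ← Con.coe_mul]; rfl
    rw [hprod]
    refine (Con.eq _).2 fun p q => ?_
    simpa using wordEval_collapse hn hf hl p.toList q.toList

end Words

theorem naryCompAt_eq_zero {n : ℕ} {F : (Fin n → X) → X} (hF : NAryAssociative n F)
    (x : ℕ → X) (i : ℕ) (hi : i ≤ n - 1) : naryCompAt n F x i = naryCompAt n F x 0 := by
  induction i with
  | zero => rfl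
  | succ i ih => rw [← hF x i hi, ih (by omega)]

theorem listOp_assoc [Nonempty X] {n : ℕ} {F : (Fin n → X) → X} (hF : NAryAssociative n F)
    (p l q : List X) (hl : l.length = n) (hpq : p.length + q.length = n - 1) :
    listOp n F (p ++ listOp n F l :: q) =
      listOp n F (listOp n F ((p ++ l ++ q).take n) :: (p ++ l ++ q).drop n) := by
  have key : ∀ p l q : List X, l.length = n → p.length + q.length = n - 1 →
      listOp n F (p ++ listOp n F l :: q) =
        naryCompAt n F (fun i => (p ++ l ++ q).getD i (Classical.arbitrary X)) p.length := by
    intro p l q hl hpq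
    rw [listOp, naryCompAt]
    congr 1
    funext j
    have hj := j.2
    split_ifs with h1 h2
    · simp [List.getElem?_append, h1]
    · simp only [h2, listOp, List.getD_eq_getElem?_getD, List.append_assoc]
      rw [List.getElem?_append_right le_rfl, Nat.sub_self, List.getElem?_cons_zero,
        Option.getD_some]
      congr 1
      funext k
      have := k.2
      rw [List.getElem?_append_right (by omega), Nat.add_sub_cancel_left,
        List.getElem?_append_left (by omega)]
    · simp [List.getElem?_append]
      grind
  rcases Nat.eq_zero_or_pos n with rfl | hn
  · rw [listOp, listOp]
    congr 1
    funext i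
    exact i.elim0
  have h0 := key [] ((p ++ l ++ q).take n) ((p ++ l ++ q).drop n) (by simp; omega)
    (by simp; omega)
  rw [List.nil_append, List.nil_append, List.take_append_drop, List.length_nil] at h0
  rw [key p l q hl hpq, h0, naryCompAt_eq_zero hF _ _ (by omega)]

theorem listOp_ofFn [Nonempty X] {n : ℕ} (F : (Fin n → X) → X) (a : Fin n → X) :
    listOp n F (List.ofFn a) = F a := by
  rw [listOp]
  congr 1
  funext i
  simp

theorem ofFn_update_const {n : ℕ} (x y : X) (p : Fin n) :
    List.ofFn (Function.update (fun _ => x) p y) =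
      List.replicate p x ++ y :: List.replicate (n - 1 - p) x := by
  have := p.2
  apply List.ext_getElem
  · simp; omega
  · intro i h1 h2
    simp only [List.getElem_ofFn, Function.update_apply, Fin.ext_iff, List.getElem_append,
      List.length_replicate, List.getElem_replicate, List.getElem_cons]
    grind

theorem memD_update_const {n : ℕ} (x y : X) (p : Fin n) :
    MemD n (n - 1) (Function.update (fun _ => x) p y) := by
  refine ⟨Finset.univ.erase p, by simp, fun i hi j hj => ?_⟩
  rw [Function.update_of_ne (Finset.ne_of_mem_erase hi),
    Function.update_of_ne (Finset.ne_of_mem_erase hj)]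

/-- If `F` is associative and quasitrivial on `D^n_{n-1}` and `F (a₁, …, aₙ)` is not among
`a₁, …, aₙ`, then all of `a₁, …, aₙ, F (a₁, …, aₙ)` are neutral for `F`.  Consequently, the
restriction of `F` to `(X \ E_F)^n` is quasitrivial. -/
theorem stmt_10 {X : Type*} [Nonempty X] (n : ℕ) (hn : 3 ≤ n)
    (F : (Fin n → X) → X) (hF : NAryAssociative n F)
    (hQ : NAryQuasitrivialOnD n (n - 1) F) :
    (∀ a : Fin n → X, F a ∉ Set.range a →
      ((∀ i, NAryNeutral n F (a i)) ∧ NAryNeutral n F (F a))) ∧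
    (∀ x : Fin n → X, (∀ i, x i ∉ naryNeutralSet n F) → F x ∈ Set.range x) := by
  have hfirst : ∀ a : Fin n → X, F a ∉ Set.range a →
      ((∀ i, NAryNeutral n F (a i)) ∧ NAryNeutral n F (F a)) := by
    obtain ⟨S, _, ι, hinj, hprod⟩ :=
      exists_monoid_embedding (by omega) (listOp_assoc hF)
    have hupd : ∀ (x y : X) (p : Fin n), ι x ^ (p : ℕ) * ι y * ι x ^ (n - 1 - (p : ℕ)) =
        ι (F (Function.update (fun _ => x) p y)) := by
      intro x y p
      have := hprod (List.ofFn (Function.update (fun _ => x) p y)) (by simp)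
      rw [listOp_ofFn, ofFn_update_const] at this
      simpa [mul_assoc] using this
    have hmem : ∀ (x y : X) (p : Fin n), F (Function.update (fun _ => x) p y) = x ∨
        F (Function.update (fun _ => x) p y) = y := by
      intro x y p
      obtain ⟨i, hi⟩ := hQ _ (memD_update_const x y p)
      rw [Function.update_apply] at hi
      split_ifs at hi
      · exact Or.inr hi.symm
      · exact Or.inl hi.symm
    have h : PowQuasitrivial ι (n - 1) := by
      refine ⟨hinj, by omega, fun x y => ?_, fun x y => ?_⟩
      · have h1 := hupd x y ⟨n - 1, by omega⟩
        simp only [Nat.sub_self, pow_zero, mul_one] at h1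
        rw [h1]
        exact (hmem x y _).imp (congrArg ι) (congrArg ι)
      · have h1 := hupd y x ⟨0, by omega⟩
        simp only [Nat.sub_zero, pow_zero, one_mul] at h1
        rw [h1]
        exact (hmem y x _).symm.imp (congrArg ι) (congrArg ι)
    have hneutral : ∀ x, (∀ y, ι x ^ (n - 1) * ι y = ι y ∧ ι y * ι x ^ (n - 1) = ι y) →
        NAryNeutral n F x := by
      intro x hx y p
      rcases hmem x y p with h1 | h1
      · have h2 := hupd x y p
        have hp : n - 1 - (p : ℕ) + p = n - 1 := by omega
        have hxy : ι y = ι x := by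
          calc ι y = ι x ^ (n - 1) * ι y * ι x ^ (n - 1) := by rw [(hx y).1, (hx y).2]
            _ = ι x ^ (n - 1 - (p : ℕ) + p) * ι y * ι x ^ (p + (n - 1 - (p : ℕ))) := by
              rw [hp, Nat.add_comm, hp]
            _ = ι x ^ (n - 1 - (p : ℕ)) *
                (ι x ^ (p : ℕ) * ι y * ι x ^ (n - 1 - (p : ℕ))) * ι x ^ (p : ℕ) := by
              rw [Nat.add_comm (p : ℕ) (n - 1 - p)]
              simp only [pow_add, mul_assoc]
            _ = ι x := by
              rw [h2, h1, ← pow_succ, ← pow_add, Nat.add_right_comm, hp, pow_succ, h.pow_mul_self]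
        rw [h1, hinj hxy]
      · exact h1
    intro a ha
    have hid := h.pow_mul_eq_of_prod_eq (List.ofFn a) (by simp; omega) (F a)
      (by rw [hprod _ (by simp), listOp_ofFn]) (by rwa [List.mem_ofFn])
    exact ⟨fun i => hneutral _ (hid _ (by simp)), hneutral _ (hid _ (by simp))⟩
  refine ⟨hfirst, fun x hx => ?_⟩
  by_contra hmem
  exact hx ⟨0, by omega⟩ ((hfirst x hmem).1 _)
end
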